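/- Let K be a field of characteristic zero and let p ∈ K[x,y,z] be an arbitrary polynomial. Define a bilinear bracket on K[x,y,z] by {f,g}_p = p · ( x·(∂_y f ∂_z g − ∂_z f ∂_y g) + y·(∂_z f ∂_x g − ∂_x f ∂_z g) + z·(∂_x f ∂_y g − ∂_y f ∂_x g) ). Then for all f, g, k ∈ K[x,y,z] the Jacobi identity holds: {f,{g,k}_p}_p + {g,{k,f}_p}_p + {k,{f,g}_p}_p = 0. In particular, the bracket determined by {x,y}' = z·p, {y,z}' = x·p, {z,x}' = y·p is a Poisson bracket, it is compatible with the Poisson–Lie bracket of so(3) (the case p = 1), and every bracket of the pencil a·{,}_{so(3)} + b·{,}' is again of this form with p replaced by a + b·p. -/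

import Mathlib

open MvPolynomial

/-- The bracket `{f,g}_p = p · ( x·(∂_y f ∂_z g − ∂_z f ∂_y g) + y·(∂_z f ∂_x g − ∂_x f ∂_z g)
+ z·(∂_x f ∂_y g − ∂_y f ∂_x g) )` on `K[x,y,z]` (variables `X 0 = x`, `X 1 = y`, `X 2 = z`).
For `p = 1` this is the `so(3)` Poisson–Lie bracket, and for a general polynomial `p` it is
the bracket determined by `{x,y}' = z·p`, `{y,z}' = x·p`, `{z,x}' = y·p`; the bracket of the
pencil `a·{,}_{so(3)} + b·{,}'` is again of this form with `p` replaced by `a + b·p`. -/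
noncomputable def soBracket {K : Type*} [Field K] (p : MvPolynomial (Fin 3) K)
    (f g : MvPolynomial (Fin 3) K) : MvPolynomial (Fin 3) K :=
  p * (X 0 * (pderiv 1 f * pderiv 2 g - pderiv 2 f * pderiv 1 g)
      + X 1 * (pderiv 2 f * pderiv 0 g - pderiv 0 f * pderiv 2 g)
      + X 2 * (pderiv 0 f * pderiv 1 g - pderiv 1 f * pderiv 0 g))

/-- Partial derivatives of multivariate polynomials commute. -/
theorem MvPolynomial.pderiv_pderiv_comm {σ R : Type*} [CommRing R] (i j : σ)
    (f : MvPolynomial σ R) : pderiv i (pderiv j f) = pderiv j (pderiv i f) := by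
  classical
  have h : ⁅pderiv (R := R) i, pderiv (R := R) j⁆ = 0 := by
    apply MvPolynomial.derivation_ext
    intro l
    simp [Derivation.commutator_apply, pderiv_X, Pi.single_apply, apply_ite]
  simpa [Derivation.commutator_apply, sub_eq_zero] using DFunLike.congr_fun h f

/-- For an arbitrary polynomial `p`, the bracket `{,}_p` satisfies the Jacobi identity; in
particular `{x,y}' = z·p, {y,z}' = x·p, {z,x}' = y·p` defines a Poisson bracket, it is
compatible with the `so(3)` Poisson–Lie bracket (the case `p = 1`), and every bracket of the
pencil `a·{,}_{so(3)} + b·{,}'` (of this same form with `p` replaced by `a + b·p`) is a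
Poisson bracket. -/
theorem soBracket_jacobi {K : Type*} [Field K] [CharZero K]
    (p : MvPolynomial (Fin 3) K) (f g k : MvPolynomial (Fin 3) K) :
    soBracket p f (soBracket p g k)
      + soBracket p g (soBracket p k f)
      + soBracket p k (soBracket p f g) = 0 := by
  have hX (i j : Fin 3) : pderiv i (X j : MvPolynomial (Fin 3) K) = if i = j then 1 else 0 := by
    simp [pderiv_X, Pi.single_apply, eq_comm]
  simp only [soBracket, map_add, map_sub, Derivation.leibniz, smul_eq_mul, hX,
    pderiv_pderiv_comm (1 : Fin 3) 0, pderiv_pderiv_comm (2 : Fin 3) 0,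
    pderiv_pderiv_comm (2 : Fin 3) 1]
  simp only [Fin.isValue, Fin.reduceEq, if_true, if_false]
  ring
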